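/- Assume h < r_u. Then x_u* = (k+2w)·(1 − r_u + h)·t_c/(2k) is the unique maximizer of Π_u over [0,1], x_u* < x₀*, x_u* is strictly decreasing in r_u, and x_u* is strictly increasing in h. -/

import Mathlib

/-- Assume `h < r_u`. Then
`x_u* = (k+2w)(1 − r_u + h)·t_c/(2k)` is the unique maximizer of `Π_u` over
`[0,1]`, `x_u* < x₀*`, `x_u*` is strictly decreasing in `r_u`, and strictly
increasing in `h`. -/
theorem stmt_15 (k w tc ru h : ℝ)
    (hk : 0 < k) (hw : 0 < w) (htc : 0 < tc) (htc' : tc < 2 * k / (k + 2 * w))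
    (hru : ru ∈ Set.Ioo (0 : ℝ) 1) (hh : h ∈ Set.Ioo (0 : ℝ) 1)
    (hadopt : h < ru) :
    let x0 : ℝ := (k + 2 * w) * tc / (2 * k)
    let xu : ℝ := (k + 2 * w) * (1 - ru + h) * tc / (2 * k)
    let Pu : ℝ → ℝ := fun x =>
      1 - (w + k * x ^ 2 / 2)
        - (w + k / 2) * (1 - x) * ((1 - ru) * tc + h * tc)
    IsMaxOn Pu (Set.Icc (0 : ℝ) 1) xu ∧
    (∀ x ∈ Set.Icc (0 : ℝ) 1, Pu x = Pu xu → x = xu) ∧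
    xu < x0 ∧
    StrictAntiOn (fun r => (k + 2 * w) * (1 - r + h) * tc / (2 * k))
      (Set.Ioo h 1) ∧
    StrictMonoOn (fun h' => (k + 2 * w) * (1 - ru + h') * tc / (2 * k))
      (Set.Ioo 0 ru) := by
  intro x0 xu Pu
  have key : ∀ x, Pu x = Pu xu - k / 2 * (x - xu) ^ 2 := by
    intro x
    simp only [Pu, xu]
    field_simp
    ring
  have hkw : 0 < k + 2 * w := by positivity
  have hc : 0 < (k + 2 * w) * tc / (2 * k) := by positivity
  have factor : ∀ a : ℝ,
      (k + 2 * w) * a * tc / (2 * k) = (k + 2 * w) * tc / (2 * k) * a := by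
    intro a
    ring
  refine ⟨?_, ?_, ?_, ?_, ?_⟩
  · intro x _
    change Pu x ≤ Pu xu
    rw [key x]
    exact sub_le_self _ (by positivity)
  · intro x _ hx
    have hzero : k / 2 * (x - xu) ^ 2 = 0 := by linarith [key x]
    have hsq : (x - xu) ^ 2 = 0 :=
      (mul_eq_zero.mp hzero).resolve_left (by positivity)
    exact sub_eq_zero.mp (pow_eq_zero_iff two_ne_zero |>.mp hsq)
  · simp only [xu, x0, factor]
    exact mul_lt_of_lt_one_right hc (by linarith)
  · intro a _ b _ hab
    simp only [factor]
    exact mul_lt_mul_of_pos_left (by linarith) hc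
  · intro a _ b _ hab
    simp only [factor]
    exact mul_lt_mul_of_pos_left (by linarith) hc
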